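/- Let p be an odd prime, q = p², and r ∈ ℕ*. Then A = (x^q − x)^{2r} ∈ F_q[x] is bi-unitary perfect over F_q if and only if r ∈ Ω. -/

import Mathlib

open Polynomial

variable {F : Type*} [Field F]

/-- `D` is a (monic) unitary divisor of `S`: `D ∣ S` and `gcd(D, S/D) = 1`. -/
def IsUnitaryDivisor (D S : Polynomial F) : Prop :=
  D.Monic ∧ D ∣ S ∧ IsCoprime D (S / D)

/-- `D` is a (monic) bi-unitary divisor of `S`: `gcd_u(D, S/D) = 1`, i.e. the only common
monic unitary divisor of `D` and `S/D` is `1`. -/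
def IsBiunitaryDivisor (D S : Polynomial F) : Prop :=
  D.Monic ∧ D ∣ S ∧
    ∀ G : Polynomial F, IsUnitaryDivisor G D → IsUnitaryDivisor G (S / D) → G = 1

/-- `σ(S)`: the sum of all monic divisors of `S`. -/
noncomputable def sigma' (S : Polynomial F) : Polynomial F :=
  ∑ᶠ D ∈ {D : Polynomial F | D.Monic ∧ D ∣ S}, D

/-- `σ**(S)`: the sum of all monic bi-unitary divisors of `S`. -/
noncomputable def sigmaStarStar (S : Polynomial F) : Polynomial F :=
  ∑ᶠ D ∈ {D : Polynomial F | IsBiunitaryDivisor D S}, D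

/-- `S` is bi-unitary perfect: `σ**(S) = S`. -/
def IsBUP (S : Polynomial F) : Prop := sigmaStarStar S = S

/-- `Ω₁ = {N ∈ ℕ* : N ∣ p²-1 and 2N+2 ∣ p²-1}`. -/
def Omega1 (p : ℕ) : Set ℕ := {N | 0 < N ∧ N ∣ (p ^ 2 - 1) ∧ (2 * N + 2) ∣ (p ^ 2 - 1)}

/-- `Ω₂ = {pN : N ∈ ℕ*, N ∣ p²-1 and 2pN+2 ∣ p²-1}`. -/
def Omega2 (p : ℕ) : Set ℕ :=
  {m | ∃ N : ℕ, 0 < N ∧ m = p * N ∧ N ∣ (p ^ 2 - 1) ∧ (2 * p * N + 2) ∣ (p ^ 2 - 1)}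

/-- `Ω₃ = {N ∈ ℕ* : N ∣ p²-1, 2N+2 = M·p with M ∣ p²-1}`. -/
def Omega3 (p : ℕ) : Set ℕ :=
  {N | 0 < N ∧ N ∣ (p ^ 2 - 1) ∧ ∃ M : ℕ, M ∣ (p ^ 2 - 1) ∧ 2 * N + 2 = M * p}

/-- `Ω₄ = {N ∈ ℕ* : N ∣ p²-1, 2N+2 = M·p² with M ∣ p²-1}`. -/
def Omega4 (p : ℕ) : Set ℕ :=
  {N | 0 < N ∧ N ∣ (p ^ 2 - 1) ∧ ∃ M : ℕ, M ∣ (p ^ 2 - 1) ∧ 2 * N + 2 = M * p ^ 2}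

/-- `Ω = Ω₁ ∪ Ω₂ ∪ Ω₃ ∪ Ω₄`. -/
def OmegaSet (p : ℕ) : Set ℕ := Omega1 p ∪ Omega2 p ∪ Omega3 p ∪ Omega4 p

section BiunitaryDivisors

/-- The highest power of `X - C a` dividing a nonzero polynomial is a unitary divisor of it. -/
lemma isUnitaryDivisor_pow_rootMultiplicity {D : F[X]} (hD : D ≠ 0) (a : F) :
    IsUnitaryDivisor ((X - C a) ^ D.rootMultiplicity a) D := by
  obtain ⟨E, hE, hdvd⟩ := exists_eq_pow_rootMultiplicity_mul_and_not_dvd D hD a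
  have hmon : ((X - C a) ^ D.rootMultiplicity a).Monic := (monic_X_sub_C a).pow _
  refine ⟨hmon, ⟨E, hE⟩, ?_⟩
  have hdiv : D / (X - C a) ^ D.rootMultiplicity a = E :=
    (EuclideanDomain.eq_div_of_mul_eq_right hmon.ne_zero hE.symm).symm
  rw [hdiv]
  exact (((irreducible_X_sub_C a).coprime_iff_not_dvd).2 hdvd).pow_left

/-- A unitary divisor has the same multiplicity as the polynomial at each of its own roots. -/
lemma IsUnitaryDivisor.rootMultiplicity_eq {G D : F[X]} (h : IsUnitaryDivisor G D) (hD : D ≠ 0)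
    {a : F} (ha : G.IsRoot a) : D.rootMultiplicity a = G.rootMultiplicity a := by
  obtain ⟨-, hdvd, hcop⟩ := h
  have hmul : G * (D / G) = D :=
    EuclideanDomain.mul_div_cancel' (ne_zero_of_dvd_ne_zero hD hdvd) hdvd
  have hroot : ¬ (D / G).IsRoot a := by
    intro h0
    exact (irreducible_X_sub_C a).not_isUnit
      (hcop.isUnit_of_dvd' (dvd_iff_isRoot.2 ha) (dvd_iff_isRoot.2 h0))
  have := rootMultiplicity_mul (p := G) (q := D / G) (x := a) (by rwa [hmul])
  rw [hmul, rootMultiplicity_eq_zero hroot] at this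
  simpa using this

lemma isBiunitaryDivisor_iff_of_splits {D S : F[X]} (hS : S.Splits) (hS0 : S ≠ 0) :
    IsBiunitaryDivisor D S ↔ D.Monic ∧ D ∣ S ∧
      ∀ a, S.IsRoot a → 2 * D.rootMultiplicity a ≠ S.rootMultiplicity a := by
  refine and_congr_right fun hD => and_congr_right fun hdvd => ?_
  have hmul : D * (S / D) = S := EuclideanDomain.mul_div_cancel' hD.ne_zero hdvd
  have hE0 : S / D ≠ 0 := by
    intro h
    rw [h, mul_zero] at hmul
    exact hS0 hmul.symm
  have hadd : ∀ a, S.rootMultiplicity a = D.rootMultiplicity a + (S / D).rootMultiplicity a := by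
    intro a
    rw [← rootMultiplicity_mul (by rwa [hmul]), hmul]
  constructor
  · intro h a ha h2
    have hpos : 0 < S.rootMultiplicity a := (rootMultiplicity_pos hS0).2 ha
    have heq : (S / D).rootMultiplicity a = D.rootMultiplicity a := by
      have := hadd a
      omega
    have hone := h _ (isUnitaryDivisor_pow_rootMultiplicity hD.ne_zero a)
      (heq ▸ isUnitaryDivisor_pow_rootMultiplicity hE0 a)
    have hdeg := congrArg natDegree hone
    rw [natDegree_pow, natDegree_X_sub_C, natDegree_one] at hdeg
    omega
  · intro h G hGD hGE
    by_contra hG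
    have hGS : G ∣ S := hGD.2.1.trans hdvd
    have hGs : G.Splits := hS.of_dvd hS0 hGS
    obtain ⟨a, ha⟩ := hGs.exists_eval_eq_zero fun hd => hG (hGD.1.degree_le_zero_iff_eq_one.1 hd.le)
    refine h a (IsRoot.dvd ha hGS) ?_
    rw [hadd a, hGD.rootMultiplicity_eq hD.ne_zero ha, hGE.rootMultiplicity_eq hE0 ha]
    ring

variable [Fintype F]

lemma rootMultiplicity_prod_X_sub_C_pow (k : F → ℕ) (a : F) :
    (∏ b, (X - C b) ^ k b).rootMultiplicity a = k a := by
  classical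
  have h0 : ∏ b, (X - C b) ^ k b ≠ 0 :=
    (monic_prod_of_monic _ _ fun b _ => (monic_X_sub_C b).pow _).ne_zero
  rw [← count_roots, roots_prod _ _ h0]
  simp [Multiset.count_bind, Multiset.count_nsmul, Multiset.count_singleton]

lemma Polynomial.Splits.eq_prod_X_sub_C_pow_rootMultiplicity {D : F[X]} (hs : D.Splits)
    (hD : D.Monic) : D = ∏ a, (X - C a) ^ D.rootMultiplicity a := by
  classical
  conv_lhs => rw [hs.eq_prod_roots_of_monic hD]
  rw [Finset.prod_multiset_map_count, Finset.prod_subset (Finset.subset_univ _)]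
  · simp [count_roots]
  · intro a _ ha
    rw [Multiset.mem_toFinset] at ha
    rw [Multiset.count_eq_zero_of_notMem ha, pow_zero]

/-- The bi-unitary divisors of `∏ a, (X - C a) ^ (2 * r)` are parametrised by the exponent
functions bounded by `2 * r` and avoiding the value `r`. -/
lemma setOf_isBiunitaryDivisor_eq_image [DecidableEq F] {r : ℕ} (hr : 0 < r) :
    {D : F[X] | IsBiunitaryDivisor D (∏ a : F, (X - C a) ^ (2 * r))} =
      (fun k : F → ℕ => ∏ a, (X - C a) ^ k a) ''
        (Fintype.piFinset fun _ : F => (Finset.range (2 * r + 1)).erase r : Finset (F → ℕ)) := by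
  set S : F[X] := ∏ a : F, (X - C a) ^ (2 * r) with hSdef
  have hS : S.Splits := Splits.prod fun a _ => (Splits.X_sub_C a).pow _
  have hS0 : S ≠ 0 := (monic_prod_of_monic _ _ fun b _ => (monic_X_sub_C b).pow _).ne_zero
  have hSm : ∀ a, S.rootMultiplicity a = 2 * r := rootMultiplicity_prod_X_sub_C_pow _
  have hroot : ∀ a, S.IsRoot a := fun a => by
    rw [← rootMultiplicity_pos hS0, hSm]
    omega
  ext D
  simp only [Set.mem_ofPred_eq, isBiunitaryDivisor_iff_of_splits hS hS0, Set.mem_image,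
    Finset.mem_coe, Fintype.mem_piFinset, Finset.mem_erase, Finset.mem_range, hSm]
  constructor
  · rintro ⟨hD, hdvd, hne⟩
    refine ⟨fun a => D.rootMultiplicity a, fun a => ?_,
      ((hS.of_dvd hS0 hdvd).eq_prod_X_sub_C_pow_rootMultiplicity hD).symm⟩
    have h1 := rootMultiplicity_le_rootMultiplicity_of_dvd hS0 hdvd a
    have h2 := hne a (hroot a)
    rw [hSm] at h1
    dsimp only
    omega
  · rintro ⟨k, hk, rfl⟩
    refine ⟨monic_prod_of_monic _ _ fun b _ => (monic_X_sub_C b).pow _,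
      Finset.prod_dvd_prod_of_dvd _ _ fun a _ => pow_dvd_pow _ ?_, fun a _ => ?_⟩
    · have := hk a
      omega
    · rw [rootMultiplicity_prod_X_sub_C_pow]
      have := hk a
      omega

lemma sigmaStarStar_prod_X_sub_C_pow {r : ℕ} (hr : 0 < r) :
    sigmaStarStar (∏ a : F, (X - C a) ^ (2 * r)) =
      ∏ a : F, ∑ k ∈ (Finset.range (2 * r + 1)).erase r, (X - C a) ^ k := by
  classical
  rw [sigmaStarStar, setOf_isBiunitaryDivisor_eq_image hr, finsum_mem_image,
    finsum_mem_coe_finset, Finset.prod_univ_sum]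
  intro k _ l _ hkl
  ext a
  rw [← rootMultiplicity_prod_X_sub_C_pow k a, ← rootMultiplicity_prod_X_sub_C_pow l a]
  exact congrArg _ hkl

end BiunitaryDivisors

section Splitting

lemma sum_erase_range_pow {R : Type*} [CommRing R] (x : R) (r : ℕ) :
    ∑ k ∈ (Finset.range (2 * r + 1)).erase r, x ^ k =
      (∑ k ∈ Finset.range r, x ^ k) * (x ^ (r + 1) + 1) := by
  have hmem : r ∈ Finset.range (2 * r + 1) := Finset.mem_range.2 (by omega)
  have h := Finset.add_sum_erase _ (fun k => x ^ k) hmem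
  have h2 : 2 * r + 1 = (r + 1) + r := by ring
  rw [h2, Finset.sum_range_add, Finset.sum_range_succ, ← h2] at h
  simp only [pow_add x (r + 1), ← Finset.mul_sum] at h
  linear_combination h

lemma splits_geom_sum_iff (r : ℕ) :
    (∑ k ∈ Finset.range r, (X : F[X]) ^ k).Splits ↔ (X ^ r - 1 : F[X]).Splits := by
  rw [← geom_sum_mul, ← C_1]
  exact (splits_mul_iff_left (X_sub_C_ne_zero 1) (Splits.X_sub_C 1)).symm

lemma splits_X_pow_add_one_iff {n : ℕ} (hn : 0 < n) :
    (X ^ n + 1 : F[X]).Splits ↔ (X ^ (2 * n) - 1 : F[X]).Splits := by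
  have hfac : (X ^ (2 * n) - 1 : F[X]) = (X ^ n - 1) * (X ^ n + 1) := by ring
  constructor
  · intro h
    have hdeg : (X ^ n + 1 : F[X]).degree ≠ 0 := by
      rw [← C_1, degree_X_pow_add_C hn]
      exact_mod_cast hn.ne'
    obtain ⟨ζ, hζ⟩ := h.exists_eval_eq_zero hdeg
    have hζ' : ζ ^ n = -1 := by
      simp only [eval_add, eval_pow, eval_X, eval_one] at hζ
      linear_combination hζ
    have hcomp := h.comp_of_natDegree_le_one (g := C ζ * X) (by compute_degree)
    have heq : (X ^ n + 1 : F[X]).comp (C ζ * X) = -(X ^ n - 1) := by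
      simp only [add_comp, X_pow_comp, one_comp, mul_pow, ← C_pow, hζ', C_neg, C_1]
      ring
    rw [heq, splits_neg_iff] at hcomp
    rw [hfac]
    exact hcomp.mul h
  · intro h
    refine h.of_dvd ?_ ⟨X ^ n - 1, by rw [hfac, mul_comm]⟩
    rw [← C_1]
    exact X_pow_sub_C_ne_zero (by omega) 1

variable [Fintype F]

variable (F) in
lemma splits_X_pow_card_sub_X : (X ^ Fintype.card F - X : F[X]).Splits := by
  rw [splits_iff_card_roots, FiniteField.roots_X_pow_card_sub_X,
    FiniteField.X_pow_card_sub_X_natDegree_eq F Fintype.one_lt_card]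
  rfl

/-- A monic polynomial over a finite field splits if and only if the product of all its translates
is a power of `∏ a, (X - C a)`. -/
lemma prod_comp_X_sub_C_eq_pow_iff {f : F[X]} (hf : f.Monic) :
    ∏ a : F, f.comp (X - C a) = (∏ a : F, (X - C a)) ^ f.natDegree ↔ f.Splits := by
  have hP : (∏ a : F, (X - C a) : F[X]).Monic := monic_prod_of_monic _ _ fun a _ => monic_X_sub_C a
  constructor
  · intro h
    have hs : (∏ a : F, (X - C a) : F[X]).Splits := Splits.prod fun a _ => Splits.X_sub_C a
    refine (hs.pow f.natDegree).of_dvd (hP.pow _).ne_zero ?_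
    have hdvd := Finset.dvd_prod_of_mem (fun a => f.comp (X - C a)) (Finset.mem_univ (0 : F))
    rwa [C_0, sub_zero, comp_X, h] at hdvd
  · intro h
    have hcomp : ∀ a : F, f.comp (X - C a) = (f.roots.map fun c => X - C (a + c)).prod := by
      intro a
      conv_lhs => rw [h.eq_prod_roots_of_monic hf]
      rw [multiset_prod_comp, Multiset.map_map]
      congr 1
      refine Multiset.map_congr rfl fun c _ => ?_
      simp only [Function.comp_apply, sub_comp, X_comp, C_comp, C_add]
      ring
    rw [Finset.prod_congr rfl fun a _ => hcomp a, ← Multiset.prod_map_prod, h.natDegree_eq_card_roots,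
      ← Multiset.prod_replicate, ← Multiset.map_const']
    congr 1
    refine Multiset.map_congr rfl fun c _ => ?_
    exact Fintype.prod_equiv (Equiv.addRight c) _ _ fun a => rfl

lemma isBUP_X_pow_card_sub_X_pow_iff {r : ℕ} (hr : 0 < r) :
    IsBUP ((X ^ Fintype.card F - X : F[X]) ^ (2 * r)) ↔
      (X ^ r - 1 : F[X]).Splits ∧ (X ^ (2 * r + 2) - 1 : F[X]).Splits := by
  set g : F[X] := ∑ k ∈ Finset.range r, X ^ k with hg
  have hgm : g.Monic := monic_geom_sum_X hr.ne'
  have hhm : (X ^ (r + 1) + 1 : F[X]).Monic := by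
    rw [← C_1]
    exact monic_X_pow_add_C 1 (by omega)
  have hdeg : (g * (X ^ (r + 1) + 1)).natDegree = 2 * r := by
    have h1 : g.natDegree + 1 = r := by
      have := congrArg natDegree (geom_sum_mul (X : F[X]) r)
      rw [← C_1, hgm.natDegree_mul (monic_X_sub_C (1 : F)), natDegree_X_sub_C,
        natDegree_X_pow_sub_C] at this
      exact this
    rw [hgm.natDegree_mul hhm, ← C_1, natDegree_X_pow_add_C]
    omega
  have hX : (X ^ Fintype.card F - X : F[X]) = ∏ a : F, (X - C a) := by
    have hc : 1 < Fintype.card F := Fintype.one_lt_card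
    have hm : (X ^ Fintype.card F - X : F[X]).Monic :=
      monic_X_pow_sub (by rw [degree_X]; exact_mod_cast hc)
    rw [(splits_X_pow_card_sub_X F).eq_prod_roots_of_monic hm,
      FiniteField.roots_X_pow_card_sub_X]
    rfl
  have hfac : ∀ a : F, ∑ k ∈ (Finset.range (2 * r + 1)).erase r, (X - C a) ^ k =
      (g * (X ^ (r + 1) + 1)).comp (X - C a) := by
    intro a
    rw [sum_erase_range_pow, hg]
    simp
  rw [IsBUP, hX, ← Finset.prod_pow, sigmaStarStar_prod_X_sub_C_pow hr,
    Finset.prod_congr rfl fun a _ => hfac a, Finset.prod_pow]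
  nth_rw 1 [← hdeg]
  rw [prod_comp_X_sub_C_eq_pow_iff (hgm.mul hhm), splits_mul hgm.ne_zero hhm.ne_zero,
    splits_geom_sum_iff r, splits_X_pow_add_one_iff r.succ_pos, Nat.succ_eq_add_one, mul_add,
    mul_one]

lemma splits_X_pow_sub_one_iff_dvd {n : ℕ} (hn : (n : F) ≠ 0) :
    (X ^ n - 1 : F[X]).Splits ↔ n ∣ Fintype.card F - 1 := by
  have hn0 : n ≠ 0 := by
    rintro rfl
    simp at hn
  have : NeZero n := ⟨hn0⟩
  constructor
  · intro h
    have hcard : n ≤ Nat.card (rootsOfUnity n F) := by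
      classical
      have hnd := nodup_roots (X_pow_sub_one_separable_iff.2 hn)
      have hc := h.natDegree_eq_card_roots
      rw [← C_1, natDegree_X_pow_sub_C, C_1] at hc
      rw [Nat.card_congr (rootsOfUnityEquivNthRoots F n), Nat.card_eq_fintype_card,
        Fintype.card_of_subtype (nthRoots n (1 : F)).toFinset fun _ => Multiset.mem_toFinset,
        nthRoots, C_1, Multiset.toFinset_card_of_nodup hnd, ← hc]
    obtain ⟨ζ, hζ⟩ := (HasEnoughRootsOfUnity.of_card_le hcard).prim
    exact hζ.dvd_of_pow_eq_one _ (FiniteField.pow_card_sub_one_eq_one ζ (hζ.ne_zero hn0))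
  · rintro ⟨m, hm⟩
    have hc : 1 < Fintype.card F := Fintype.one_lt_card
    have h0 := FiniteField.X_pow_card_sub_X_ne_zero F hc
    refine (splits_X_pow_card_sub_X F).of_dvd h0 ?_
    have hfac : (X ^ Fintype.card F - X : F[X]) = ((X ^ n) ^ m - 1 ^ m) * X := by
      rw [← pow_mul, ← hm, one_pow, sub_mul, ← pow_succ, one_mul, Nat.sub_add_cancel hc.le]
    rw [hfac]
    exact (sub_dvd_pow_sub_pow _ _ m).mul_right _

lemma splits_X_pow_sub_one_iff (p : ℕ) [Fact p.Prime] [CharP F p] {n : ℕ} (hn : 0 < n) :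
    (X ^ n - 1 : F[X]).Splits ↔ ∃ a N, n = p ^ a * N ∧ N ∣ Fintype.card F - 1 := by
  have hp : p.Prime := Fact.out
  have key : ∀ a N : ℕ, 0 < N → (N : F) ≠ 0 →
      ((X ^ (p ^ a * N) - 1 : F[X]).Splits ↔ N ∣ Fintype.card F - 1) := by
    intro a N hN hNF
    have h0 : (X ^ N - 1 : F[X]) ≠ 0 := by
      rw [← C_1]
      exact X_pow_sub_C_ne_zero hN 1
    have hpow : (X ^ (p ^ a * N) - 1 : F[X]) = (X ^ N - 1) ^ p ^ a := by
      rw [sub_pow_char_pow, one_pow, ← pow_mul, mul_comm]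
    rw [hpow, ← splits_X_pow_sub_one_iff_dvd hNF]
    refine ⟨fun h => h.of_dvd (pow_ne_zero _ h0) (dvd_pow_self _ (pow_pos hp.pos a).ne'),
      fun h => h.pow _⟩
  constructor
  · intro h
    obtain ⟨a, N, hN, rfl⟩ := Nat.exists_eq_pow_mul_and_not_dvd hn.ne' p hp.ne_one
    exact ⟨a, N, rfl, (key a N (Nat.pos_of_mul_pos_left hn)
      (by rwa [Ne, CharP.cast_eq_zero_iff F p])).1 h⟩
  · rintro ⟨a, N, rfl, hN⟩
    refine (key a N (Nat.pos_of_ne_zero ?_) ?_).2 hN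
    · rintro rfl
      simp at hn
    · intro h0
      have h1 : ((Fintype.card F - 1 : ℕ) : F) = 0 := by
        obtain ⟨m, hm⟩ := hN
        rw [hm, Nat.cast_mul, h0, zero_mul]
      rw [Nat.cast_sub Fintype.card_pos, Nat.cast_card_eq_zero F] at h1
      simp at h1

end Splitting

lemma mem_OmegaSet_iff {p r : ℕ} (hp : p.Prime) (hodd : Odd p) (hr : 0 < r) :
    r ∈ OmegaSet p ↔ (∃ a N, r = p ^ a * N ∧ N ∣ p ^ 2 - 1) ∧
      ∃ b M, 2 * r + 2 = p ^ b * M ∧ M ∣ p ^ 2 - 1 := by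
  have hp3 : 3 ≤ p := by
    have := hp.two_le
    obtain ⟨k, hk⟩ := hodd
    omega
  have hpos : 0 < p ^ 2 - 1 := by
    have : 3 ^ 2 ≤ p ^ 2 := Nat.pow_le_pow_left hp3 2
    omega
  constructor
  · rintro (((⟨-, h1, h2⟩ | ⟨N, -, rfl, h1, h2⟩) | ⟨-, h1, M, h2, h3⟩) | ⟨-, h1, M, h2, h3⟩)
    · exact ⟨⟨0, r, by simp, h1⟩, 0, 2 * r + 2, by simp, h2⟩
    · exact ⟨⟨1, N, by simp, h1⟩, 0, 2 * p * N + 2, by ring, h2⟩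
    · exact ⟨⟨0, r, by simp, h1⟩, 1, M, by rw [h3]; ring, h2⟩
    · exact ⟨⟨0, r, by simp, h1⟩, 2, M, by rw [h3]; ring, h2⟩
  · rintro ⟨⟨a, N, hrN, hN⟩, b, M, hrM, hM⟩
    have hNpos : 0 < N := Nat.pos_of_dvd_of_pos hN hpos
    have hMpos : 0 < M := Nat.pos_of_dvd_of_pos hM hpos
    have hNle := Nat.le_of_dvd hpos hN
    have hMle := Nat.le_of_dvd hpos hM
    rcases Nat.eq_zero_or_pos a with rfl | ha
    · rw [pow_zero, one_mul] at hrN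
      subst hrN
      have hb : b < 3 := by
        by_contra! hb
        have h1 : p ^ 3 ≤ p ^ b := Nat.pow_le_pow_right hp.pos hb
        have h2 : p ^ b ≤ p ^ b * M := Nat.le_mul_of_pos_right _ hMpos
        have h3 : 3 * p ^ 2 ≤ p ^ 3 := by
          rw [pow_succ p 2, mul_comm]
          exact Nat.mul_le_mul_left _ hp3
        omega
      interval_cases b
      · rw [pow_zero, one_mul] at hrM
        exact .inl (.inl (.inl ⟨hr, hN, hrM ▸ hM⟩))
      · exact .inl (.inr ⟨hr, hN, M, hM, by rw [hrM]; ring⟩)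
      · exact .inr ⟨hr, hN, M, hM, by rw [hrM]; ring⟩
    · have hpr : p ∣ r := hrN ▸ (dvd_pow_self p ha.ne').mul_right N
      have hb : b = 0 := by
        by_contra hb
        have h1 : p ∣ 2 * r + 2 := hrM ▸ (dvd_pow_self p hb).mul_right M
        have h2 : p ∣ 2 := (Nat.dvd_add_right (hpr.mul_left 2)).1 h1
        have := Nat.le_of_dvd two_pos h2
        omega
      subst hb
      rw [pow_zero, one_mul] at hrM
      have ha1 : a < 2 := by
        by_contra! ha2
        have h1 : p ^ 2 ≤ p ^ a := Nat.pow_le_pow_right hp.pos ha2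
        have h2 : p ^ a ≤ p ^ a * N := Nat.le_mul_of_pos_right _ hNpos
        omega
      obtain rfl : a = 1 := by omega
      rw [pow_one] at hrN
      refine .inl (.inl (.inr ⟨N, hNpos, hrN, hN, ?_⟩))
      rwa [mul_assoc, ← hrN, hrM]

theorem stmt19 (p : ℕ) [Fact p.Prime] (hp : Odd p) (r : ℕ) (hr : 0 < r) :
    IsBUP ((X ^ (p ^ 2) - X : Polynomial (GaloisField p 2)) ^ (2 * r)) ↔
      r ∈ OmegaSet p := by
  have := Fintype.ofFinite (GaloisField p 2)
  have hcard : Fintype.card (GaloisField p 2) = p ^ 2 := by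
    rw [← Nat.card_eq_fintype_card, GaloisField.card p 2 two_ne_zero]
  rw [mem_OmegaSet_iff Fact.out hp hr, ← hcard, isBUP_X_pow_card_sub_X_pow_iff hr,
    splits_X_pow_sub_one_iff p hr, splits_X_pow_sub_one_iff p (by omega : 0 < 2 * r + 2)]
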